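/- arXiv:2504.08484 — 3 statements merged into one kernel-verified Lean document; each statement's English description precedes it below -/
import Mathlib

section
/- Let Z be a real m×t matrix, Y a real n×t matrix, and G a symmetric positive semidefinite m×m real matrix. Then there exists a real n×m matrix M satisfying Y = M·Z and Mᵀ·M ⪯ G if and only if Yᵀ·Y ⪯ Zᵀ·G·Z. -/
open Matrix
open scoped MatrixOrder

/-- A linear form of Douglas' lemma: a map dominated in norm by `w` factors through `w` via a
contraction. -/
theorem LinearMap.exists_contraction_comp_eq {V E F : Type*} [AddCommGroup V] [Module ℝ V]
    [NormedAddCommGroup E] [InnerProductSpace ℝ E] [FiniteDimensional ℝ E]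
    [NormedAddCommGroup F] [InnerProductSpace ℝ F] (w : V →ₗ[ℝ] E) (y : V →ₗ[ℝ] F)
    (h : ∀ v, ‖y v‖ ≤ ‖w v‖) :
    ∃ c : E →ₗ[ℝ] F, (∀ v, c (w v) = y v) ∧ ∀ e, ‖c e‖ ≤ ‖e‖ := by
  obtain ⟨s, hs⟩ := w.rangeRestrict.exists_rightInverse_of_surjective w.range_rangeRestrict
  have hws (r : w.range) : w (s r) = r := congrArg Subtype.val (LinearMap.congr_fun hs r)
  let P := w.range.orthogonalProjectionOnto
  refine ⟨y ∘ₗ s ∘ₗ P.toLinearMap, fun v => ?_, fun e => ?_⟩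
  · have hP : P (w v) = w.rangeRestrict v :=
      w.range.orthogonalProjectionOnto_mem_subspace_eq_self (w.rangeRestrict v)
    have hz := h (s (P (w v)) - v)
    rw [map_sub w, hws, hP] at hz
    simpa [sub_eq_zero, hP] using hz
  · calc ‖y (s (P e))‖ ≤ ‖w (s (P e))‖ := h _
      _ = ‖P e‖ := by rw [hws]; rfl
      _ ≤ ‖e‖ := w.range.norm_orthogonalProjectionOnto_apply_le e

theorem Matrix.dotProduct_transpose_mul_self_mulVec {m n : Type*} [Fintype m] [Fintype n]
    (A : Matrix m n ℝ) (x : n → ℝ) :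
    x ⬝ᵥ ((Aᵀ * A) *ᵥ x) = ‖WithLp.toLp 2 (A *ᵥ x)‖ ^ 2 := by
  rw [← mulVec_mulVec, dotProduct_mulVec, vecMul_transpose, EuclideanSpace.real_norm_sq_eq]
  simp [dotProduct, sq]

theorem Matrix.posSemidef_transpose_mul_self_sub_iff {l m n : Type*} [Fintype l] [Fintype m]
    [Fintype n] (A : Matrix m n ℝ) (B : Matrix l n ℝ) :
    (Aᵀ * A - Bᵀ * B).PosSemidef ↔
      ∀ x : n → ℝ, ‖WithLp.toLp 2 (B *ᵥ x)‖ ≤ ‖WithLp.toLp 2 (A *ᵥ x)‖ := by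
  have hherm : (Aᵀ * A - Bᵀ * B).IsHermitian :=
    (isHermitian_conjTranspose_mul_self A).sub (isHermitian_conjTranspose_mul_self B)
  rw [posSemidef_iff_dotProduct_mulVec, and_iff_right hherm]
  refine forall_congr' fun x => ?_
  rw [star_trivial, sub_mulVec, dotProduct_sub, dotProduct_transpose_mul_self_mulVec,
    dotProduct_transpose_mul_self_mulVec, sub_nonneg,
    sq_le_sq₀ (norm_nonneg _) (norm_nonneg _)]

/-- Proposition 1: there exists `M` with `Y = M * Z` and `Mᵀ * M ⪯ G`
iff `Yᵀ * Y ⪯ Zᵀ * G * Z`. -/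
theorem stmt_0 {m t n : ℕ} (Z : Matrix (Fin m) (Fin t) ℝ) (Y : Matrix (Fin n) (Fin t) ℝ)
    (G : Matrix (Fin m) (Fin m) ℝ) (hG : G.PosSemidef) :
    (∃ M : Matrix (Fin n) (Fin m) ℝ, Y = M * Z ∧ (G - Mᵀ * M).PosSemidef) ↔
      (Zᵀ * G * Z - Yᵀ * Y).PosSemidef := by
  constructor
  · rintro ⟨M, rfl, hM⟩
    simpa [Matrix.mul_sub, Matrix.sub_mul, Matrix.mul_assoc]
      using hM.conjTranspose_mul_mul_same Z
  · intro h
    obtain ⟨S, rfl⟩ : ∃ S : Matrix (Fin m) (Fin m) ℝ, G = Sᵀ * S :=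
      CStarAlgebra.nonneg_iff_eq_star_mul_self.mp hG.nonneg
    rw [show Zᵀ * (Sᵀ * S) * Z = (S * Z)ᵀ * (S * Z) by simp [Matrix.mul_assoc],
      posSemidef_transpose_mul_self_sub_iff] at h
    obtain ⟨c, hc, hcn⟩ := LinearMap.exists_contraction_comp_eq (toEuclideanLin (S * Z))
      (toEuclideanLin Y) fun v => h v.ofLp
    obtain ⟨C, rfl⟩ := toEuclideanLin.surjective c
    refine ⟨C * S, ?_, ?_⟩
    · refine ext_of_mulVec_single fun i => ?_
      have hi := congrArg WithLp.ofLp (hc (WithLp.toLp 2 (Pi.single i 1)))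
      simp only [toLpLin_apply, mulVec_mulVec] at hi
      rw [← hi, Matrix.mul_assoc]
    · rw [posSemidef_transpose_mul_self_sub_iff]
      intro x
      simpa [toLpLin_apply] using hcn (WithLp.toLp 2 (S *ᵥ x))
end

section
/- Let Z be a real m×t matrix, Y a real n×t matrix, G a symmetric positive semidefinite m×m real matrix, and set D := Zᵀ·G·Z − Yᵀ·Y. Assume D is positive semidefinite and let D⁺ be its Moore–Penrose pseudoinverse. Then (I_t − D·D⁺)·Zᵀ = 0 if and only if rank(D) = rank(Z). -/
open Matrix

theorem Matrix.ker_mulVecLin_le_of_posSemidef_sub {m t n : Type*} [Fintype m] [Fintype t]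
    [Fintype n] [DecidableEq t]
    (Z : Matrix m t ℝ) (Y : Matrix n t ℝ) (G : Matrix m m ℝ)
    (hD : (Zᵀ * G * Z - Yᵀ * Y).PosSemidef) :
    LinearMap.ker Z.mulVecLin ≤ LinearMap.ker (Zᵀ * G * Z - Yᵀ * Y).mulVecLin := by
  intro x hx
  simp only [LinearMap.mem_ker, mulVecLin_apply] at hx ⊢
  rw [← hD.dotProduct_mulVec_zero_iff]
  refine le_antisymm ?_ (hD.dotProduct_mulVec_nonneg x)
  have hY : x ⬝ᵥ ((Yᵀ * Y) *ᵥ x) = (Y *ᵥ x) ⬝ᵥ (Y *ᵥ x) := by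
    rw [← mulVec_mulVec, dotProduct_mulVec, vecMul_transpose]
  have hnonneg : 0 ≤ (Y *ᵥ x) ⬝ᵥ (Y *ᵥ x) :=
    Finset.sum_nonneg fun i _ => mul_self_nonneg _
  rw [star_trivial, sub_mulVec, dotProduct_sub, hY, ← mulVec_mulVec, hx, mulVec_zero,
    dotProduct_zero]
  linarith

theorem Matrix.rank_add_finrank_ker_mulVecLin {m t : Type*} [Fintype m] [Fintype t]
    (A : Matrix m t ℝ) :
    A.rank + Module.finrank ℝ (LinearMap.ker A.mulVecLin) = Fintype.card t := by
  rw [Matrix.rank, LinearMap.finrank_range_add_finrank_ker, Module.finrank_fintype_fun_eq_card]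

theorem Matrix.mul_eq_zero_of_ker_mulVecLin_le {m n t k : Type*} [Fintype t]
    {A : Matrix m t ℝ} {B : Matrix n t ℝ} {C : Matrix t k ℝ}
    (h : LinearMap.ker A.mulVecLin ≤ LinearMap.ker B.mulVecLin) (hA : A * C = 0) :
    B * C = 0 := by
  ext i j
  have hcol : C.col j ∈ LinearMap.ker A.mulVecLin := by
    ext l
    exact congrFun (congrFun hA l) j
  exact congrFun (h hcol) i

/-- Lemma 2: for `D = Zᵀ G Z - Yᵀ Y ⪰ 0`,
`(I - D D⁺) Zᵀ = 0` iff `rank D = rank Z`. -/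
theorem stmt_6 {m t n : ℕ} (Z : Matrix (Fin m) (Fin t) ℝ) (Y : Matrix (Fin n) (Fin t) ℝ)
    (G : Matrix (Fin m) (Fin m) ℝ) (hG : G.PosSemidef)
    (D : Matrix (Fin t) (Fin t) ℝ) (hDdef : D = Zᵀ * G * Z - Yᵀ * Y)
    (hD : D.PosSemidef)
    (Dp : Matrix (Fin t) (Fin t) ℝ)
    (hDp1 : D * Dp * D = D) (hDp2 : Dp * D * Dp = Dp)
    (hDp3 : (D * Dp)ᵀ = D * Dp) (hDp4 : (Dp * D)ᵀ = Dp * D) :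
    ((1 : Matrix (Fin t) (Fin t) ℝ) - D * Dp) * Zᵀ = 0 ↔ D.rank = Z.rank := by
  have hker : LinearMap.ker Z.mulVecLin ≤ LinearMap.ker D.mulVecLin := by
    subst hDdef
    exact ker_mulVecLin_le_of_posSemidef_sub Z Y G hD
  have hsymm : Dᵀ = D := by simpa using hD.isHermitian.eq
  have hrankD := rank_add_finrank_ker_mulVecLin D
  have hrankZ := rank_add_finrank_ker_mulVecLin Z
  have hfinrank := Submodule.finrank_mono hker
  constructor
  · intro h
    rw [Matrix.sub_mul, Matrix.one_mul, sub_eq_zero, Matrix.mul_assoc] at h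
    have hle : Z.rank ≤ D.rank := by
      rw [← rank_transpose Z, h]
      exact rank_mul_le_left _ _
    omega
  · intro h
    have heq : LinearMap.ker Z.mulVecLin = LinearMap.ker D.mulVecLin :=
      Submodule.eq_of_le_of_finrank_eq hker (by omega)
    have hzero : D * (1 - D * Dp) = 0 := by
      have hDDp := congrArg transpose hDp1
      rw [transpose_mul, hDp3, hsymm] at hDDp
      rw [Matrix.mul_sub, Matrix.mul_one, hDDp, sub_self]
    have hZ := congrArg transpose (mul_eq_zero_of_ker_mulVecLin_le heq.ge hzero)
    rwa [transpose_mul, transpose_sub, transpose_one, hDp3, transpose_zero] at hZ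
end

section
/- (Noise-free prediction, ellipsoid case.) Let X, X₊ be real n×t matrices, U a real m×t matrix, B a real n×m matrix, L > 0, and set D := L²·Xᵀ·X − (X₊ − B·U)ᵀ·(X₊ − B·U). Assume D is positive semidefinite and rank(D) = rank(X); let D⁺ and X⁺ be the Moore–Penrose pseudoinverses of D and X respectively. Fix x ∈ ℝⁿ and u ∈ ℝ^m, and define 𝒜 := Iₙ + (X₊ − B·U)·D⁺·(X₊ − B·U)ᵀ, c := (X₊ − B·U)·X⁺·x, and Q := L²·xᵀ·(Iₙ − X·D⁺·D·X⁺)·x. Then 𝒜 is symmetric positive definite and the set { x₊ ∈ ℝⁿ : there exists a real n×n matrix A with Aᵀ·A ⪯ L²·Iₙ, X₊ − B·U = A·X, and x₊ = A·x + B·u } equals the ellipsoid { x₊ ∈ ℝⁿ : (x₊ − B·u − c)ᵀ·𝒜·(x₊ − B·u − c) ≤ Q }. -/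
open Matrix

/-- If every vector killed by `M` is killed by `N` and `M * P = M`, then `N * P = N`. -/
lemma Matrix.mul_eq_self_of_ker_le {l m n : Type*} [Fintype n] [DecidableEq n]
    {M : Matrix m n ℝ} {N : Matrix l n ℝ} {P : Matrix n n ℝ}
    (hker : ∀ v, M *ᵥ v = 0 → N *ᵥ v = 0) (hP : M * P = M) : N * P = N := by
  refine Matrix.ext_of_mulVec_single fun i => ?_
  have h := hker (P *ᵥ Pi.single i 1 - Pi.single i 1) (by
    rw [mulVec_sub, mulVec_mulVec, hP, sub_self])
  rwa [mulVec_sub, mulVec_mulVec, sub_eq_zero] at h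

/-- If `ker M ≤ ker N` and the two matrices have the same rank, the kernels coincide. -/
lemma Matrix.ker_le_of_rank_eq {l m n : Type*} [Fintype n] [DecidableEq n]
    {M : Matrix m n ℝ} {N : Matrix l n ℝ}
    (hker : ∀ v, M *ᵥ v = 0 → N *ᵥ v = 0) (hrank : N.rank = M.rank) (v : n → ℝ)
    (hv : N *ᵥ v = 0) : M *ᵥ v = 0 := by
  have hle : LinearMap.ker M.mulVecLin ≤ LinearMap.ker N.mulVecLin := fun w hw => by
    simpa using hker w (by simpa using hw)
  have hM := LinearMap.finrank_range_add_finrank_ker M.mulVecLin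
  have hN := LinearMap.finrank_range_add_finrank_ker N.mulVecLin
  unfold Matrix.rank at hrank
  have heq := Submodule.eq_of_le_of_finrank_eq hle (by omega)
  have hv' : v ∈ LinearMap.ker M.mulVecLin := by
    rw [heq]; simpa using hv
  simpa using hv'

/-- The Moore–Penrose pseudoinverse of a symmetric matrix is symmetric. -/
lemma Matrix.transpose_pinv_eq_self {n : Type*} [Fintype n] {D P : Matrix n n ℝ}
    (hD : Dᵀ = D) (h1 : D * P * D = D) (h2 : P * D * P = P)
    (h3 : (D * P)ᵀ = D * P) (h4 : (P * D)ᵀ = P * D) : Pᵀ = P := by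
  rw [transpose_mul, hD] at h3 h4
  have h1' : D * Pᵀ * D = D := by
    have := congrArg transpose h1
    rwa [transpose_mul, transpose_mul, hD, ← Matrix.mul_assoc] at this
  have h2' : Pᵀ * D * Pᵀ = Pᵀ := by
    have := congrArg transpose h2
    rwa [transpose_mul, transpose_mul, hD, ← Matrix.mul_assoc] at this
  have hcomm : D * P = P * D := calc
    D * P = D * Pᵀ * D * P := by rw [h1']
    _ = P * (D * (D * P)) := by rw [h4]; simp only [Matrix.mul_assoc]
    _ = P * (D * Pᵀ * D) := by rw [← h3]; simp only [Matrix.mul_assoc]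
    _ = P * D := by rw [h1']
  rw [← h2', h3, hcomm, Matrix.mul_assoc, h4, ← hcomm, ← Matrix.mul_assoc, h2]

/-- The value of the quadratic form of `L² XᵀX - YᵀY`. -/
lemma Matrix.dotProduct_gram_sub_mulVec {l m n : Type*} [Fintype l] [Fintype m] [Fintype n]
    (X : Matrix l n ℝ) (Y : Matrix m n ℝ) (L : ℝ) (v : n → ℝ) :
    v ⬝ᵥ ((L ^ 2 • (Xᵀ * X) - Yᵀ * Y) *ᵥ v) =
      L ^ 2 * (X *ᵥ v ⬝ᵥ X *ᵥ v) - Y *ᵥ v ⬝ᵥ Y *ᵥ v := by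
  rw [sub_mulVec, dotProduct_sub, smul_mulVec, dotProduct_smul, ← mulVec_mulVec,
    ← mulVec_mulVec, dotProduct_mulVec v Xᵀ, dotProduct_mulVec v Yᵀ, vecMul_transpose,
    vecMul_transpose, smul_eq_mul]

/-- `AᵀA ⪯ L² I` iff `A` is `L`-Lipschitz for the Euclidean norm. -/
lemma Matrix.posSemidef_smul_one_sub_transpose_mul_self_iff {m n : Type*} [Fintype m] [Fintype n]
    [DecidableEq n] (A : Matrix m n ℝ) (L : ℝ) :
    (L ^ 2 • (1 : Matrix n n ℝ) - Aᵀ * A).PosSemidef ↔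
      ∀ p, A *ᵥ p ⬝ᵥ A *ᵥ p ≤ L ^ 2 * (p ⬝ᵥ p) := by
  have key (p : n → ℝ) : p ⬝ᵥ ((L ^ 2 • (1 : Matrix n n ℝ) - Aᵀ * A) *ᵥ p) =
      L ^ 2 * (p ⬝ᵥ p) - A *ᵥ p ⬝ᵥ A *ᵥ p := by
    simpa using dotProduct_gram_sub_mulVec (1 : Matrix n n ℝ) A L p
  constructor
  · intro h p
    have := h.dotProduct_mulVec_nonneg p
    rw [star_trivial, key] at this
    linarith
  · intro h
    refine PosSemidef.of_dotProduct_mulVec_nonneg ?_ fun p => ?_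
    · simp [IsHermitian, conjTranspose_eq_transpose_of_trivial]
    · rw [star_trivial, key]
      linarith [h p]

/-- Corollary 2, ellipsoid case: in the noise-free setting, with
`D = L² Xᵀ X - (X₊ - BU)ᵀ (X₊ - BU) ⪰ 0` and `rank D = rank X`, the set of feasible next
states is the ellipsoid with shape `𝒜 = I + (X₊ - BU) D⁺ (X₊ - BU)ᵀ`, center `Bu + c` with
`c = (X₊ - BU) X⁺ x`, and radius `Q = L² xᵀ (I - X D⁺ D X⁺) x`. -/
theorem stmt_12 {n t md : ℕ} (X Xp : Matrix (Fin n) (Fin t) ℝ)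
    (U : Matrix (Fin md) (Fin t) ℝ) (B : Matrix (Fin n) (Fin md) ℝ)
    (L : ℝ) (hL : 0 < L)
    (D : Matrix (Fin t) (Fin t) ℝ)
    (hDdef : D = L ^ 2 • (Xᵀ * X) - (Xp - B * U)ᵀ * (Xp - B * U))
    (hD : D.PosSemidef) (hrank : D.rank = X.rank)
    (Dp : Matrix (Fin t) (Fin t) ℝ)
    (hDp1 : D * Dp * D = D) (hDp2 : Dp * D * Dp = Dp)
    (hDp3 : (D * Dp)ᵀ = D * Dp) (hDp4 : (Dp * D)ᵀ = Dp * D)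
    (Xpi : Matrix (Fin t) (Fin n) ℝ)
    (hXpi1 : X * Xpi * X = X) (hXpi2 : Xpi * X * Xpi = Xpi)
    (hXpi3 : (X * Xpi)ᵀ = X * Xpi) (hXpi4 : (Xpi * X)ᵀ = Xpi * X)
    (x : Fin n → ℝ) (u : Fin md → ℝ) :
    letI 𝒜 : Matrix (Fin n) (Fin n) ℝ := 1 + (Xp - B * U) * Dp * (Xp - B * U)ᵀ
    letI c : Fin n → ℝ := ((Xp - B * U) * Xpi) *ᵥ x
    letI Q : ℝ := L ^ 2 * (x ⬝ᵥ (((1 : Matrix (Fin n) (Fin n) ℝ) - X * Dp * D * Xpi) *ᵥ x))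
    𝒜.PosDef ∧
      {xp : Fin n → ℝ | ∃ A : Matrix (Fin n) (Fin n) ℝ,
          (L ^ 2 • (1 : Matrix (Fin n) (Fin n) ℝ) - Aᵀ * A).PosSemidef ∧
          Xp - B * U = A * X ∧ xp = A *ᵥ x + B *ᵥ u} =
        {xp : Fin n → ℝ |
          (xp - B *ᵥ u - c) ⬝ᵥ (𝒜 *ᵥ (xp - B *ᵥ u - c)) ≤ Q} := by
  generalize Xp - B * U = Y at *
  set 𝒜 : Matrix (Fin n) (Fin n) ℝ := 1 + Y * Dp * Yᵀ
  set c : Fin n → ℝ := (Y * Xpi) *ᵥ x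
  set Q : ℝ := L ^ 2 * (x ⬝ᵥ ((1 - X * Dp * D * Xpi) *ᵥ x))
  have hDq (v : Fin t → ℝ) :
      v ⬝ᵥ (D *ᵥ v) = L ^ 2 * (X *ᵥ v ⬝ᵥ X *ᵥ v) - Y *ᵥ v ⬝ᵥ Y *ᵥ v := by
    rw [hDdef, dotProduct_gram_sub_mulVec]
  have hD0 (v : Fin t → ℝ) : 0 ≤ v ⬝ᵥ (D *ᵥ v) := by
    simpa using hD.dotProduct_mulVec_nonneg v
  have hDt : Dᵀ = D := by simpa [conjTranspose_eq_transpose_of_trivial] using hD.isHermitian.eq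
  have hXY (v : Fin t → ℝ) (hv : X *ᵥ v = 0) : Y *ᵥ v = 0 := by
    have h := hD0 v
    rw [hDq, hv] at h
    simp only [dotProduct_zero, mul_zero, zero_sub] at h
    have h' : 0 ≤ Y *ᵥ v ⬝ᵥ Y *ᵥ v := by simpa using dotProduct_star_self_nonneg (Y *ᵥ v)
    exact dotProduct_self_eq_zero.mp (by linarith)
  have hXD (v : Fin t → ℝ) (hv : X *ᵥ v = 0) : D *ᵥ v = 0 := by
    rw [hDdef, sub_mulVec, smul_mulVec, ← mulVec_mulVec, ← mulVec_mulVec, hv, hXY v hv]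
    simp
  have hDX := ker_le_of_rank_eq hXD hrank
  have hX : X * (Dp * D) = X := mul_eq_self_of_ker_le hDX (by rw [← Matrix.mul_assoc, hDp1])
  have hY : Y * (Dp * D) = Y :=
    mul_eq_self_of_ker_le (fun v hv => hXY v (hDX v hv)) (by rw [← Matrix.mul_assoc, hDp1])
  have hYX : Y * (Xpi * X) = Y := mul_eq_self_of_ker_le hXY (by rw [← Matrix.mul_assoc, hXpi1])
  have hDpt : Dpᵀ = Dp := transpose_pinv_eq_self hDt hDp1 hDp2 hDp3 hDp4
  have hDpos : Dp.PosSemidef := by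
    have := hD.conjTranspose_mul_mul_same Dp
    rwa [conjTranspose_eq_transpose_of_trivial, hDpt, hDp2] at this
  have hA : 𝒜.PosDef := by
    refine PosDef.one.add_posSemidef ?_
    have := hDpos.mul_mul_conjTranspose_same Y
    rwa [conjTranspose_eq_transpose_of_trivial] at this
  refine ⟨hA, ?_⟩
  set w : Fin n → ℝ := x - X *ᵥ (Xpi *ᵥ x) with hw
  have hXX (p : Fin n → ℝ) : Xᵀ *ᵥ (p - X *ᵥ (Xpi *ᵥ p)) = 0 := by
    have h : Xᵀ * (X * Xpi) = Xᵀ := by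
      have := congrArg transpose hXpi1
      rwa [transpose_mul, hXpi3] at this
    rw [mulVec_sub, mulVec_mulVec, mulVec_mulVec, Matrix.mul_assoc, h, sub_self]
  have horth (p : Fin n → ℝ) (v : Fin t → ℝ) : (p - X *ᵥ (Xpi *ᵥ p)) ⬝ᵥ X *ᵥ v = 0 := by
    rw [dotProduct_mulVec, ← mulVec_transpose, hXX, zero_dotProduct]
  have hwx : w ⬝ᵥ x = w ⬝ᵥ w := by
    have := horth x (Xpi *ᵥ x)
    nth_rw 3 [hw]
    rw [dotProduct_sub, this, sub_zero]
  have hQ : Q = L ^ 2 * (w ⬝ᵥ w) := by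
    have : X * Dp * D * Xpi = X * Xpi := by rw [Matrix.mul_assoc X, hX]
    simp only [Q]
    rw [this, sub_mulVec, one_mulVec, ← mulVec_mulVec, ← hw, dotProduct_comm, hwx]
  have hAq (z : Fin n → ℝ) :
      z ⬝ᵥ 𝒜 *ᵥ z = z ⬝ᵥ z + z ⬝ᵥ Y *ᵥ (Dp *ᵥ (Yᵀ *ᵥ z)) := by
    simp only [𝒜, add_mulVec, one_mulVec, dotProduct_add, ← mulVec_mulVec]
  have hDv (z : Fin n → ℝ) : D *ᵥ (Dp *ᵥ (Yᵀ *ᵥ z)) = Yᵀ *ᵥ z := by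
    have := congrArg transpose hY
    rw [transpose_mul, transpose_mul, hDt, hDpt] at this
    rw [mulVec_mulVec, mulVec_mulVec, this]
  have hYz (z : Fin n → ℝ) (v : Fin t → ℝ) : v ⬝ᵥ Yᵀ *ᵥ z = z ⬝ᵥ Y *ᵥ v := by
    rw [mulVec_transpose, dotProduct_comm, ← dotProduct_mulVec]
  ext xp
  simp only [Set.mem_ofPred_eq, posSemidef_smul_one_sub_transpose_mul_self_iff]
  constructor
  · rintro ⟨A, hAL, hAX, rfl⟩
    have hz : A *ᵥ x + B *ᵥ u - B *ᵥ u - c = A *ᵥ w := by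
      simp only [c, hAX, hw, mulVec_sub, mulVec_mulVec, add_sub_cancel_right, Matrix.mul_assoc]
    rw [hz, hQ, hAq]
    set z := A *ᵥ w
    set v := Dp *ᵥ (Yᵀ *ᵥ z) with hv
    have h1 := hAL (w + X *ᵥ v)
    have h2 : A *ᵥ (w + X *ᵥ v) = z + Y *ᵥ v := by
      rw [mulVec_add, mulVec_mulVec, ← hAX]
    have h3 := horth x v
    have h4 := hDq v
    have h5 : v ⬝ᵥ D *ᵥ v = z ⬝ᵥ Y *ᵥ v := by rw [hv, hDv, hYz]
    rw [h2] at h1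
    simp only [add_dotProduct, dotProduct_add, dotProduct_comm (X *ᵥ v) w,
      dotProduct_comm (Y *ᵥ v) z, ← hw] at h1 h3
    rw [h3] at h1
    linarith
  · intro h
    set z := xp - B *ᵥ u - c with hz
    rw [hQ] at h
    have hα (p : Fin n → ℝ) : (Y * Xpi + (w ⬝ᵥ w)⁻¹ • vecMulVec z w) *ᵥ p =
        Y *ᵥ (Xpi *ᵥ p) + ((w ⬝ᵥ w)⁻¹ * (w ⬝ᵥ p)) • z := by
      rw [add_mulVec, smul_mulVec, vecMulVec_mulVec, mulVec_mulVec, mul_smul]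
      simp
    refine ⟨Y * Xpi + (w ⬝ᵥ w)⁻¹ • vecMulVec z w, fun p => ?_, ?_, ?_⟩
    · rw [hα]
      set v := Xpi *ᵥ p with hv
      set α := (w ⬝ᵥ w)⁻¹ * (w ⬝ᵥ p) with hαdef
      set q := p - X *ᵥ v with hq
      have hp : p = q + X *ᵥ v := by rw [hq]; abel
      have hqv : q ⬝ᵥ X *ᵥ v = 0 := horth p v
      have hwv : w ⬝ᵥ X *ᵥ v = 0 := horth x v
      have hpp : p ⬝ᵥ p = q ⬝ᵥ q + X *ᵥ v ⬝ᵥ X *ᵥ v := by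
        rw [hp]
        simp only [add_dotProduct, dotProduct_add, dotProduct_comm (X *ᵥ v) q, hqv]
        ring
      have hwp : w ⬝ᵥ p = w ⬝ᵥ q := by rw [hp, dotProduct_add, hwv, add_zero]
      have hww : α * (w ⬝ᵥ w) = w ⬝ᵥ q ∨ α = 0 := by
        by_cases h0 : w ⬝ᵥ w = 0
        · right; simp [hαdef, h0]
        · left; rw [hαdef, hwp]; field_simp
      have hnn (y : Fin n → ℝ) : 0 ≤ y ⬝ᵥ y := by simpa using dotProduct_star_self_nonneg y
      have hbd : α ^ 2 * (w ⬝ᵥ w) ≤ q ⬝ᵥ q := by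
        rcases hww with hww | h0
        · have := hnn (q - α • w)
          simp only [sub_dotProduct, dotProduct_sub, smul_dotProduct, dotProduct_smul,
            smul_eq_mul, dotProduct_comm q w, ← hww] at this
          linarith
        · simpa [h0] using hnn q
      set s := Dp *ᵥ (Yᵀ *ᵥ z) with hs
      have hsq := hD0 (v - α • s)
      have hDs : D *ᵥ s = Yᵀ *ᵥ z := hDv z
      have hsv : s ⬝ᵥ D *ᵥ v = z ⬝ᵥ Y *ᵥ v := by
        rw [dotProduct_mulVec, ← mulVec_transpose, hDt, hDs, dotProduct_comm, hYz]
      simp only [mulVec_sub, mulVec_smul, sub_dotProduct, dotProduct_sub, smul_dotProduct,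
        dotProduct_smul, smul_eq_mul, hDs, hsv, hYz] at hsq
      rw [hDq] at hsq
      rw [hAq, ← hs] at h
      rw [hpp]
      simp only [add_dotProduct, dotProduct_add, smul_dotProduct, dotProduct_smul, smul_eq_mul,
        dotProduct_comm (Y *ᵥ v) z]
      have h1 := mul_le_mul_of_nonneg_left h (sq_nonneg α)
      have h2 := mul_le_mul_of_nonneg_left hbd (sq_nonneg L)
      linarith
    · have hwX : w ᵥ* X = 0 := by rw [← mulVec_transpose, hXX]
      have hzX : vecMulVec z w * X = 0 := by
        rw [vecMulVec_mul, hwX]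
        ext i j
        simp [vecMulVec_apply]
      rw [Matrix.add_mul, Matrix.mul_assoc, hYX, Matrix.smul_mul, hzX, smul_zero, add_zero]
    · rw [hα, hwx]
      have : ((w ⬝ᵥ w)⁻¹ * (w ⬝ᵥ w)) • z = z := by
        by_cases h0 : w ⬝ᵥ w = 0
        · have hz0 : z = 0 := by
            by_contra hne
            have := hA.dotProduct_mulVec_pos hne
            rw [star_trivial] at this
            rw [h0] at h
            linarith
          rw [hz0, smul_zero]
        · rw [inv_mul_cancel₀ h0, one_smul]
      rw [this, hz, mulVec_mulVec]
      simp only [c]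
      abel
end
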